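/- arXiv:1809.09698 — 2 statements merged into one kernel-verified Lean document; each statement's English description precedes it below -/
import Mathlib

section
/- Let n ≥ 1 be a natural number, let ε ∈ (0,1) be a real number, and let F be an n×n real symmetric positive semidefinite matrix with λ_max(F) > 0. Then there exists a unique θ* ∈ (λ_max(F), ∞) satisfying (ε·θ*/n)·Tr((θ*·I − F)^{-1}) = 1, and this θ* is the unique minimizer of the function Φ(x) := ln x − (ε/n)·ln det(x·I − F) over (λ_max(F), ∞). -/
lemma aux_spec {n : ℕ} (F : Matrix (Fin n) (Fin n) ℝ) (hF : F.IsHermitian) (x : ℝ)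
    (hx : ∀ i, hF.eigenvalues i < x) :
    (x • (1 : Matrix (Fin n) (Fin n) ℝ) - F).det = ∏ i, (x - hF.eigenvalues i) ∧
    ((x • (1 : Matrix (Fin n) (Fin n) ℝ) - F)⁻¹).trace = ∑ i, (x - hF.eigenvalues i)⁻¹ := by
  obtain ⟨U, V, hUV, hVU, hs⟩ : ∃ U V : Matrix (Fin n) (Fin n) ℝ, U * V = 1 ∧ V * U = 1 ∧
      F = U * Matrix.diagonal hF.eigenvalues * V := by
    refine ⟨hF.eigenvectorUnitary, star (hF.eigenvectorUnitary : Matrix (Fin n) (Fin n) ℝ),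
      by simp, by simp, ?_⟩
    have := hF.spectral_theorem
    rw [Unitary.conjStarAlgAut_apply] at this
    exact this
  generalize hF.eigenvalues = μ at *
  have h1 : x • (1 : Matrix (Fin n) (Fin n) ℝ) - F
      = U * Matrix.diagonal (fun i => x - μ i) * V := by
    have : Matrix.diagonal (fun i => x - μ i)
        = x • (1 : Matrix (Fin n) (Fin n) ℝ) - Matrix.diagonal μ := by
      rw [Matrix.smul_one_eq_diagonal, Matrix.diagonal_sub]
    rw [this, mul_sub, sub_mul, ← hs]
    simp [hUV]
  have h2 : (x • (1 : Matrix (Fin n) (Fin n) ℝ) - F)⁻¹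
      = U * Matrix.diagonal (fun i => (x - μ i)⁻¹) * V := by
    apply Matrix.inv_eq_right_inv
    rw [h1]
    calc _ = U * Matrix.diagonal (fun i => x - μ i) * (V * U) *
          Matrix.diagonal (fun i => (x - μ i)⁻¹) * V := by simp only [mul_assoc]
      _ = U * (Matrix.diagonal (fun i => x - μ i) *
          Matrix.diagonal (fun i => (x - μ i)⁻¹)) * V := by rw [hVU]; simp only [mul_assoc, one_mul]
      _ = 1 := by
        rw [Matrix.diagonal_mul_diagonal]
        have : (fun i => (x - μ i) * (x - μ i)⁻¹) = fun _ => (1 : ℝ) := by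
          funext i
          exact mul_inv_cancel₀ (sub_pos.2 (hx i)).ne'
        rw [this, Matrix.diagonal_one, mul_one, hUV]
  constructor
  · rw [h1, Matrix.det_mul_right_comm, hUV, one_mul, Matrix.det_diagonal]
  · rw [h2, Matrix.trace_mul_comm, ← mul_assoc, hVU, one_mul, Matrix.trace_diagonal]

lemma aux_min {n : ℕ} (hn : 1 ≤ n) (ε : ℝ) (hε : ε ∈ Set.Ioo (0 : ℝ) 1)
    (μ : Fin n → ℝ) (θ x : ℝ) (hθ : 0 < θ) (hx : 0 < x)
    (hθμ : ∀ i, μ i < θ) (hxμ : ∀ i, μ i < x)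
    (h : (ε * θ / (n : ℝ)) * ∑ i, (θ - μ i)⁻¹ = 1) (hne : x ≠ θ) :
    Real.log θ - (ε / (n : ℝ)) * Real.log (∏ i, (θ - μ i)) <
      Real.log x - (ε / (n : ℝ)) * Real.log (∏ i, (x - μ i)) := by
  have hn0 : (0 : ℝ) < n := by exact_mod_cast hn
  have a1 : ∀ i, θ - μ i ≠ 0 := fun i => (sub_pos.2 (hθμ i)).ne'
  have a2 : ∀ i, x - μ i ≠ 0 := fun i => (sub_pos.2 (hxμ i)).ne'
  rw [Real.log_prod (fun i _ => a1 i), Real.log_prod (fun i _ => a2 i)]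
  have key : ∀ i, Real.log (x - μ i) - Real.log (θ - μ i) + Real.log θ - Real.log x
      ≤ θ / x - 1 + (1 - θ / x) * θ * (θ - μ i)⁻¹ := by
    intro i
    have p1 := sub_pos.2 (hθμ i)
    have p2 := sub_pos.2 (hxμ i)
    have := Real.log_le_sub_one_of_pos (x := (x - μ i) * θ / ((θ - μ i) * x)) (by positivity)
    rw [Real.log_div (by positivity) (by positivity), Real.log_mul p2.ne' hθ.ne',
      Real.log_mul p1.ne' hx.ne'] at this
    have e : (x - μ i) * θ / ((θ - μ i) * x) - 1
        = θ / x - 1 + (1 - θ / x) * θ * (θ - μ i)⁻¹ := by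
      have := p1.ne'
      field_simp
      ring
    linarith
  have hs := Finset.sum_le_sum (fun i (_ : i ∈ Finset.univ) => key i)
  simp only [Finset.sum_add_distrib, Finset.sum_sub_distrib, ← Finset.mul_sum,
    Finset.sum_const, Finset.card_univ, Fintype.card_fin, nsmul_eq_mul] at hs
  have hs2 := mul_le_mul_of_nonneg_left hs (div_pos hε.1 hn0).le
  have hlt := Real.log_lt_sub_one_of_pos (x := θ / x) (by positivity)
    (by intro h; exact hne ((div_eq_one_iff_eq hx.ne').1 h).symm)
  rw [Real.log_div hθ.ne' hx.ne'] at hlt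
  have hlt2 := mul_lt_mul_of_pos_left hlt (sub_pos.2 hε.2)
  generalize ∑ i, (θ - μ i)⁻¹ = S at *
  generalize ∑ i, Real.log (x - μ i) = A at *
  generalize ∑ i, Real.log (θ - μ i) = B at *
  have hcan : ε / n * n = ε := by field_simp
  have e1 : ε / n * (A - B + n * Real.log θ - n * Real.log x)
      = ε / n * A - ε / n * B + ε * (Real.log θ - Real.log x) := by
    linear_combination (Real.log θ - Real.log x) * hcan
  have e2 : ε / n * (n * (θ / x) - n * 1 + (1 - θ / x) * θ * S)
      = ε * (θ / x - 1) + (1 - θ / x) := by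
    linear_combination (θ / x - 1) * hcan + (1 - θ / x) * h
  rw [mul_one] at e2 hs2
  nlinarith

lemma aux_exists {n : ℕ} (hn : 1 ≤ n) (ε : ℝ) (hε : ε ∈ Set.Ioo (0 : ℝ) 1)
    (μ : Fin n → ℝ) (lam : ℝ) (hlam : 0 < lam) (hle : ∀ i, μ i ≤ lam)
    (i0 : Fin n) (hi0 : μ i0 = lam) :
    ∃ θ, lam < θ ∧ (ε * θ / (n : ℝ)) * ∑ i, (θ - μ i)⁻¹ = 1 := by
  have hn0 : (0 : ℝ) < n := by exact_mod_cast hn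
  have hn1 : (1 : ℝ) ≤ n := by exact_mod_cast hn
  obtain ⟨h0, h1⟩ := hε
  have h1' := sub_pos.2 h1
  have ha : lam < lam + ε * lam / n := by
    have : 0 < ε * lam / n := by positivity
    linarith
  have hab : lam + ε * lam / n ≤ lam / (1 - ε) := by
    have : ε * lam / n ≤ ε * lam := div_le_self (by positivity) hn1
    rw [le_div_iff₀ h1']
    nlinarith [mul_pos h0 hlam, mul_pos h0 (mul_pos h0 hlam)]
  have hc : ContinuousOn (fun θ : ℝ => (ε * θ / (n : ℝ)) * ∑ i, (θ - μ i)⁻¹)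
      (Set.Icc (lam + ε * lam / n) (lam / (1 - ε))) := by
    apply ContinuousOn.mul (by fun_prop)
    apply continuousOn_finsetSum
    intro i _
    apply ContinuousOn.inv₀ (by fun_prop)
    intro x hx
    have := hx.1
    have := hle i
    exact (by linarith : 0 < x - μ i).ne'
  have hv := intermediate_value_Icc' hab hc
  suffices hmem : _ ∧ _ by
    obtain ⟨θ, hθ, he⟩ := hv (Set.mem_Icc.2 hmem)
    exact ⟨θ, lt_of_lt_of_le ha hθ.1, he⟩
  constructor
  · set b := lam / (1 - ε) with hb
    have hbl : lam < b := lt_of_lt_of_le ha hab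
    have hS : ∑ i, (b - μ i)⁻¹ ≤ ∑ _i : Fin n, (b - lam)⁻¹ := by
      apply Finset.sum_le_sum
      intro i _
      exact inv_anti₀ (by linarith) (by linarith [hle i])
    simp only [Finset.sum_const, Finset.card_univ, Fintype.card_fin, nsmul_eq_mul] at hS
    have hb0 : 0 < b := hlam.trans hbl
    have e : b - lam = ε * b := by rw [hb]; field_simp; ring
    calc _ ≤ ε * b / n * (n * (b - lam)⁻¹) := mul_le_mul_of_nonneg_left hS (by positivity)
      _ = 1 := by rw [e]; field_simp
  · set a := lam + ε * lam / n with haa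
    have hS : (a - μ i0)⁻¹ ≤ ∑ i, (a - μ i)⁻¹ := by
      apply Finset.single_le_sum (f := fun i => (a - μ i)⁻¹) _ (Finset.mem_univ i0)
      intro i _
      exact inv_nonneg.2 (by linarith [hle i])
    have hal : a - μ i0 = ε * lam / n := by rw [hi0, haa]; ring
    rw [hal] at hS
    have ha0 : 0 < a := hlam.trans ha
    calc (1 : ℝ) = ε * lam / n * (ε * lam / n)⁻¹ := by field_simp
      _ ≤ ε * a / n * (ε * lam / n)⁻¹ := by gcongr
      _ ≤ _ := mul_le_mul_of_nonneg_left hS (by positivity)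


/-- For `ε ∈ (0,1)` and PSD symmetric `F` with `λ_max(F) > 0`, there is a
unique `θ* > λ_max(F)` with `(ε·θ*/n)·Tr((θ*·I - F)⁻¹) = 1`, and this `θ*` is the unique
minimizer of `Φ(x) = ln x - (ε/n)·ln det (x·I - F)` on `(λ_max(F), ∞)`. -/
theorem log_potential_unique_minimizer
    {n : ℕ} (hn : 1 ≤ n) (ε : ℝ) (hε : ε ∈ Set.Ioo (0 : ℝ) 1)
    (F : Matrix (Fin n) (Fin n) ℝ) (hF : F.PosSemidef)
    (lam : ℝ) (hlam : lam = ⨆ i, hF.1.eigenvalues i) (hlampos : 0 < lam) :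
    ∃ θ ∈ Set.Ioi lam,
      (ε * θ / (n : ℝ)) * ((θ • (1 : Matrix (Fin n) (Fin n) ℝ) - F)⁻¹).trace = 1 ∧
      (∀ θ' ∈ Set.Ioi lam,
        (ε * θ' / (n : ℝ)) * ((θ' • (1 : Matrix (Fin n) (Fin n) ℝ) - F)⁻¹).trace = 1 →
        θ' = θ) ∧
      (∀ x ∈ Set.Ioi lam, x ≠ θ →
        Real.log θ - (ε / (n : ℝ)) *
            Real.log (θ • (1 : Matrix (Fin n) (Fin n) ℝ) - F).det <
          Real.log x - (ε / (n : ℝ)) *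
            Real.log (x • (1 : Matrix (Fin n) (Fin n) ℝ) - F).det) := by
  have hbdd : BddAbove (Set.range hF.1.eigenvalues) := (Set.finite_range _).bddAbove
  have hle : ∀ i, hF.1.eigenvalues i ≤ lam := fun i => hlam ▸ le_ciSup hbdd i
  haveI : Nonempty (Fin n) := ⟨⟨0, hn⟩⟩
  obtain ⟨i0, hi0⟩ := exists_eq_ciSup_of_finite (f := hF.1.eigenvalues)
  obtain ⟨θ, hθ, he⟩ := aux_exists hn ε hε hF.1.eigenvalues lam hlampos hle i0 (hi0.trans hlam.symm)
  have hsp : ∀ x, lam < x → _ := fun x hx =>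
    aux_spec F hF.1 x (fun i => (hle i).trans_lt hx)
  have hmin : ∀ θ x, lam < θ → lam < x →
      (ε * θ / (n : ℝ)) * ∑ i, (θ - hF.1.eigenvalues i)⁻¹ = 1 → x ≠ θ → _ :=
    fun θ x hθ hx h hne => aux_min hn ε hε hF.1.eigenvalues θ x (hlampos.trans hθ)
      (hlampos.trans hx) (fun i => (hle i).trans_lt hθ) (fun i => (hle i).trans_lt hx) h hne
  refine ⟨θ, hθ, ?_, ?_, ?_⟩
  · rw [(hsp θ hθ).2, he]
  · intro θ' hθ' h'
    rw [(hsp θ' hθ').2] at h'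
    by_contra hne
    exact lt_asymm (hmin θ θ' hθ hθ' he hne) (hmin θ' θ hθ' hθ h' (Ne.symm hne))
  · intro x hx hne
    rw [(hsp θ hθ).1, (hsp x hx).1]
    exact hmin θ x hθ hx he hne
end

section
/- Let n ≥ 1 be a natural number, let ε ∈ (0, 1/2) be a real number, let F be an n×n real symmetric positive semidefinite matrix with λ_max(F) > 0, and define g(x) := (ε·x/n)·Tr((x·I − F)^{-1}) for x > λ_max(F). Then: (a) if θ* > λ_max(F) satisfies g(θ*) = 1, then λ_max(F)/(1−ε/n) ≤ θ* ≤ λ_max(F)/(1−ε); and (b) if θ > λ_max(F) satisfies 1 − ε < g(θ) ≤ 1, then λ_max(F)/(1−ε/n) ≤ θ ≤ (1−ε)·λ_max(F)/(1−2ε). -/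
theorem trace_inv_aux {n : ℕ} (F : Matrix (Fin n) (Fin n) ℝ) (hF : F.IsHermitian) (x : ℝ)
    (hx : ∀ i, hF.eigenvalues i < x) :
    ((x • (1 : Matrix (Fin n) (Fin n) ℝ) - F)⁻¹).trace = ∑ i, (x - hF.eigenvalues i)⁻¹ := by
  set U : Matrix (Fin n) (Fin n) ℝ := (hF.eigenvectorUnitary : Matrix (Fin n) (Fin n) ℝ) with hU
  have h1 : U * star U = 1 := Unitary.coe_mul_star_self hF.eigenvectorUnitary
  have h2 : star U * U = 1 := Unitary.coe_star_mul_self hF.eigenvectorUnitary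
  have hs : F = U * Matrix.diagonal hF.eigenvalues * star U := by
    have := hF.spectral_theorem
    rw [Unitary.conjStarAlgAut_apply] at this
    exact this
  have hd : Matrix.diagonal (fun i => x - hF.eigenvalues i) =
      x • (1 : Matrix (Fin n) (Fin n) ℝ) - Matrix.diagonal hF.eigenvalues := by
    rw [Matrix.smul_one_eq_diagonal, Matrix.diagonal_sub]
  have hx' : x • (1 : Matrix (Fin n) (Fin n) ℝ) - F =
      U * Matrix.diagonal (fun i => x - hF.eigenvalues i) * star U := by
    rw [hd, mul_sub, sub_mul, ← hs]
    simp [h1]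
  have hdd : Matrix.diagonal (fun i => x - hF.eigenvalues i) *
      Matrix.diagonal (fun i => (x - hF.eigenvalues i)⁻¹) = 1 := by
    rw [Matrix.diagonal_mul_diagonal, ← Matrix.diagonal_one]
    congr 1
    funext i
    exact mul_inv_cancel₀ (sub_pos.2 (hx i)).ne'
  have hinv : (x • (1 : Matrix (Fin n) (Fin n) ℝ) - F)⁻¹ =
      U * Matrix.diagonal (fun i => (x - hF.eigenvalues i)⁻¹) * star U := by
    apply Matrix.inv_eq_right_inv
    rw [hx']
    calc _ = U * (Matrix.diagonal (fun i => x - hF.eigenvalues i) * (star U * U) *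
      Matrix.diagonal (fun i => (x - hF.eigenvalues i)⁻¹)) * star U := by
          simp only [mul_assoc]
      _ = 1 := by rw [h2, mul_one, hdd, mul_one, h1]
  rw [hinv, Matrix.trace_mul_comm, ← mul_assoc, h2, one_mul, Matrix.trace_diagonal]

/-- (a) if `g(θ*) = 1` for `θ* > λ_max(F)` then
`λ_max(F)/(1-ε/n) ≤ θ* ≤ λ_max(F)/(1-ε)`; (b) if `1-ε < g(θ) ≤ 1` for `θ > λ_max(F)`
then `λ_max(F)/(1-ε/n) ≤ θ ≤ (1-ε)·λ_max(F)/(1-2ε)`. -/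
theorem theta_approximates_lambda_max
    {n : ℕ} (hn : 1 ≤ n) (ε : ℝ) (hε : ε ∈ Set.Ioo (0 : ℝ) (1 / 2))
    (F : Matrix (Fin n) (Fin n) ℝ) (hF : F.PosSemidef)
    (lam : ℝ) (hlam : lam = ⨆ i, hF.1.eigenvalues i) (hlampos : 0 < lam)
    (g : ℝ → ℝ)
    (hg : ∀ x : ℝ,
      g x = (ε * x / (n : ℝ)) * ((x • (1 : Matrix (Fin n) (Fin n) ℝ) - F)⁻¹).trace) :
    (∀ θs ∈ Set.Ioi lam, g θs = 1 →
      lam / (1 - ε / (n : ℝ)) ≤ θs ∧ θs ≤ lam / (1 - ε)) ∧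
    (∀ θ ∈ Set.Ioi lam, 1 - ε < g θ → g θ ≤ 1 →
      lam / (1 - ε / (n : ℝ)) ≤ θ ∧ θ ≤ (1 - ε) * lam / (1 - 2 * ε)) := by
  obtain ⟨hε0, hε1⟩ := hε
  have hn1 : (1 : ℝ) ≤ n := by exact_mod_cast hn
  have hn0 : (0 : ℝ) < n := by linarith
  haveI : Nonempty (Fin n) := ⟨⟨0, hn⟩⟩
  have hle : ∀ i, hF.1.eigenvalues i ≤ lam := fun i => by
    rw [hlam]; exact le_ciSup (Set.finite_range _).bddAbove i
  obtain ⟨j, hj⟩ := exists_eq_ciSup_of_finite (f := hF.1.eigenvalues)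
  rw [← hlam] at hj
  have hεn : ε / n ≤ ε := div_le_self hε0.le hn1
  have lower : ∀ x, lam < x → g x ≤ 1 → lam / (1 - ε / (n : ℝ)) ≤ x := by
    intro x hx h
    rw [hg, trace_inv_aux F hF.1 x fun i => (hle i).trans_lt hx] at h
    have hx0 : 0 < x - lam := sub_pos.2 hx
    have hT : (x - lam)⁻¹ ≤ ∑ i, (x - hF.1.eigenvalues i)⁻¹ := by
      rw [← hj]
      exact Finset.single_le_sum (f := fun i => (x - hF.1.eigenvalues i)⁻¹)
        (fun i _ => inv_nonneg.2 (by linarith [hle i])) (Finset.mem_univ j)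
    have hc : 0 ≤ ε * x / n := div_nonneg (mul_nonneg hε0.le (by linarith)) hn0.le
    have h3 := (mul_le_mul_of_nonneg_left hT hc).trans h
    rw [← div_eq_mul_inv, div_le_one hx0] at h3
    rw [div_le_iff₀ (by linarith)]
    have : ε * x / n = x * (ε / n) := by ring
    linarith
  have upper : ∀ x c, lam < x → c ≤ g x → x * (c - ε) ≤ c * lam := by
    intro x c hx h
    rw [hg, trace_inv_aux F hF.1 x fun i => (hle i).trans_lt hx] at h
    have hx0 : 0 < x - lam := sub_pos.2 hx
    have hT : ∑ i, (x - hF.1.eigenvalues i)⁻¹ ≤ n * (x - lam)⁻¹ := by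
      have := Finset.sum_le_card_nsmul Finset.univ (fun i => (x - hF.1.eigenvalues i)⁻¹)
        ((x - lam)⁻¹) (fun i _ => inv_anti₀ hx0 (by linarith [hle i]))
      simpa using this
    have hc : 0 ≤ ε * x / n := div_nonneg (mul_nonneg hε0.le (by linarith)) hn0.le
    have h3 := h.trans (mul_le_mul_of_nonneg_left hT hc)
    have h4 : ε * x / n * (n * (x - lam)⁻¹) = ε * x / (x - lam) := by
      field_simp
    rw [h4, le_div_iff₀ hx0] at h3
    linarith
  refine ⟨fun x hx h => ⟨lower x hx h.le, ?_⟩, fun x hx h h' => ⟨lower x hx h', ?_⟩⟩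
  · have := upper x 1 hx h.ge
    rw [le_div_iff₀ (by linarith)]
    linarith
  · have := upper x (1 - ε) hx h.le
    rw [le_div_iff₀ (by linarith)]
    linarith
end
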